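/- Let n ≥ 3 be a natural number and, for 0 ≤ k ≤ n−1, let p_k = exp(2πik/n) ∈ ℂ be the n-th roots of unity, viewed as the vertices of a regular n-gon on the unit circle in the Euclidean plane ℂ. Then for every k with 1 ≤ k ≤ n−1, sin(∠ 0 p_0 p_k) ≤ cos(π/n) = sin(π/2 − π/n), where ∠ 0 p_0 p_k is the unoriented angle at the vertex p_0 between the direction toward the circle's center 0 and the direction toward p_k. (This is the geometric content of the paper's theorem that a single pursuer at the center of the circle with v_p/v_e ≥ sin(π/2 − π/n) blocks every moving lane of the evader: every lane direction from p_0 makes an angle with the direction to the center whose sine is at most cos(π/n).) -/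

import Mathlib

open EuclideanGeometry Real

/-- For the vertices `p k = exp(2πik/n)` of a regular `n`-gon on the unit circle in `ℂ`,
every lane direction from `p 0` makes an angle with the direction toward the center `0`
whose sine is at most `cos(π/n) = sin(π/2 − π/n)`. -/
theorem sin_angle_center_le_cos (n : ℕ) (hn : 3 ≤ n)
    (p : ℕ → ℂ) (hp : ∀ k, p k = Complex.exp (2 * Real.pi * Complex.I * k / n))
    (k : ℕ) (hk1 : 1 ≤ k) (hk2 : k ≤ n - 1) :
    Real.sin (∠ (0 : ℂ) (p 0) (p k)) ≤ Real.cos (Real.pi / n) ∧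
      Real.cos (Real.pi / n) = Real.sin (Real.pi / 2 - Real.pi / n) := by
  have hn0 : (0 : ℝ) < n := by exact_mod_cast (by omega : 0 < n)
  have hπ := Real.pi_pos
  have ha0 : 0 < Real.pi / n := by positivity
  have ha2 : Real.pi / n ≤ Real.pi / 2 := by
    apply div_le_div_of_nonneg_left hπ.le (by norm_num)
    exact_mod_cast (by omega : 2 ≤ n)
  refine ⟨?_, (Real.sin_pi_div_two_sub _).symm⟩
  obtain ⟨t, ht⟩ : ∃ t : ℝ, t = k * (Real.pi / n) := ⟨_, rfl⟩
  have hk1' : (1 : ℝ) ≤ k := by exact_mod_cast hk1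
  have hk2' : (k : ℝ) + 1 ≤ n := by exact_mod_cast (by omega : k + 1 ≤ n)
  have ht1 : Real.pi / n ≤ t := by rw [ht]; nlinarith
  have hpn : n * (Real.pi / n) = Real.pi := by field_simp
  have ht2 : t ≤ Real.pi - Real.pi / n := by rw [ht]; nlinarith
  have hst : Real.sin (Real.pi / n) ≤ Real.sin t := by
    rcases le_total t (Real.pi / 2) with h | h
    · exact Real.sin_le_sin_of_le_of_le_pi_div_two (by linarith) h ht1
    · rw [← Real.sin_pi_sub t]
      exact Real.sin_le_sin_of_le_of_le_pi_div_two (by linarith) (by linarith) (by linarith)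
  have hs0 : 0 < Real.sin (Real.pi / n) := Real.sin_pos_of_pos_of_lt_pi ha0 (by linarith)
  have hp0 : p 0 = 1 := by simp [hp]
  have hpk : p k - 1 = (2 * Real.sin t) • (⟨-Real.sin t, Real.cos t⟩ : ℂ) := by
    have : p k = Complex.exp (((2 * t : ℝ) : ℂ) * Complex.I) := by
      rw [hp, ht]; congr 1; push_cast; ring
    rw [this]
    apply Complex.ext
    · simp only [Complex.sub_re, Complex.exp_ofReal_mul_I_re, Complex.one_re, Complex.real_smul,
        Complex.re_ofReal_mul]
      rw [Real.cos_two_mul]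
      linarith [Real.sin_sq_add_cos_sq t]
    · simp only [Complex.sub_im, Complex.exp_ofReal_mul_I_im, Complex.one_im, Complex.real_smul,
        Complex.im_ofReal_mul]
      rw [Real.sin_two_mul]
      ring
  have hw : ‖(⟨-Real.sin t, Real.cos t⟩ : ℂ)‖ = 1 := by
    rw [Complex.norm_def, Complex.normSq_mk, Real.sqrt_eq_one]
    linarith [Real.sin_sq_add_cos_sq t]
  have hcos : Real.cos (∠ (0 : ℂ) (p 0) (p k)) = Real.sin t := by
    unfold EuclideanGeometry.angle
    rw [hp0, vsub_eq_sub, vsub_eq_sub, hpk,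
      InnerProductGeometry.angle_smul_right_of_pos _ _ (by linarith),
      InnerProductGeometry.cos_angle, hw]
    simp [Complex.inner]
  have h1 := Real.sin_sq_add_cos_sq (∠ (0 : ℂ) (p 0) (p k))
  have h2 := Real.sin_sq_add_cos_sq (Real.pi / n)
  rw [hcos] at h1
  refine le_of_abs_le (abs_le_of_sq_le_sq ?_ (Real.cos_nonneg_of_neg_pi_div_two_le_of_le (by linarith) ha2))
  nlinarith
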